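/- arXiv:1005.0751 — 2 statements merged into one kernel-verified Lean document; each statement's English description precedes it below -/
import Mathlib

section
/- (Uniformly colocated level sets, part 1) For every ε > 0 there exist a radius r > 0 and a neighborhood N of x₀ such that the closed ball of radius r about y₀ times N is contained in D, and for every y in the open ball of radius r/(1 + ε) about y₀ and every x ∈ N, there exists y₁ in the open ball of radius r about y₀ with F¹(y₁, x) = F(y, x) and ‖y₁ − y‖ ≤ ε·‖y − y₀‖. -/
open Filter Topology Set

/-- The partial Fréchet derivative of `F` with respect to the first variable. -/
noncomputable def D1 {E X P : Type*}
    [NormedAddCommGroup E] [NormedSpace ℝ E]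
    [NormedAddCommGroup X] [NormedSpace ℝ X]
    [NormedAddCommGroup P] [NormedSpace ℝ P]
    (F : E × X → P) (y : E) (x : X) : E →L[ℝ] P :=
  fderiv ℝ (fun y' => F (y', x)) y

/-- Uniformly colocated level sets, part 1: for every `ε > 0` there are `r > 0` and a
neighborhood `N` of `x₀` with `closedBall y₀ r × N ⊆ D`, such that every
`y ∈ ball y₀ (r/(1+ε))` and `x ∈ N` admit `y₁ ∈ ball y₀ r` with
`F¹(y₁,x) = F(y,x)` and `‖y₁ − y‖ ≤ ε·‖y − y₀‖`,
where `F¹(y,x) = D₁F(y₀,x)(y − y₀) + F(y₀,x)`. -/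
theorem stmt_9 {E X P : Type*}
    [NormedAddCommGroup E] [NormedSpace ℝ E] [FiniteDimensional ℝ E]
    [NormedAddCommGroup X] [NormedSpace ℝ X] [FiniteDimensional ℝ X]
    [NormedAddCommGroup P] [NormedSpace ℝ P] [FiniteDimensional ℝ P]
    (D : Set (E × X)) (hD : IsOpen D) (y₀ : E) (x₀ : X) (hmem : (y₀, x₀) ∈ D)
    (F : E × X → P) (hF : ContDiffOn ℝ 1 F D) (hF0 : F (y₀, x₀) = 0)
    (hsurj : Function.Surjective (D1 F y₀ x₀)) :
    ∀ ε > (0 : ℝ), ∃ r > (0 : ℝ), ∃ N ∈ 𝓝 x₀,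
      (Metric.closedBall y₀ r) ×ˢ N ⊆ D ∧
      ∀ y ∈ Metric.ball y₀ (r / (1 + ε)), ∀ x ∈ N,
        ∃ y₁ ∈ Metric.ball y₀ r,
          D1 F y₀ x (y₁ - y₀) + F (y₀, x) = F (y, x) ∧
          ‖y₁ - y‖ ≤ ε * ‖y - y₀‖ := by
  intro ε hε
  have hcont : ContinuousOn (fderiv ℝ F) D := hF.continuousOn_fderiv_of_isOpen hD le_rfl
  have hder : ∀ y x, (y, x) ∈ D → HasFDerivAt (fun y' => F (y', x)) (D1 F y x) y := by
    intro y x h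
    have h1 : HasFDerivAt F (fderiv ℝ F (y, x)) (y, x) :=
      ((hF.differentiableOn (by norm_num)).differentiableAt (hD.mem_nhds h)).hasFDerivAt
    have h2 : HasFDerivAt (fun y' => F (y', x))
        ((fderiv ℝ F (y, x)).comp (ContinuousLinearMap.inl ℝ E X)) y :=
      HasFDerivAt.comp (f := fun e : E => (e, x)) y h1 (hasFDerivAt_prodMk_left y x)
    exact h2.differentiableAt.hasFDerivAt
  have hD1 : ∀ y x, (y, x) ∈ D →
      D1 F y x = (fderiv ℝ F (y, x)).comp (ContinuousLinearMap.inl ℝ E X) := by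
    intro y x h
    have h1 : HasFDerivAt F (fderiv ℝ F (y, x)) (y, x) :=
      ((hF.differentiableOn (by norm_num)).differentiableAt (hD.mem_nhds h)).hasFDerivAt
    exact (hder y x h).unique (HasFDerivAt.comp (f := fun e : E => (e, x)) y h1 (hasFDerivAt_prodMk_left y x))
  have hDn : D ∈ 𝓝 (y₀, x₀) := hD.mem_nhds hmem
  have hc0 : ContinuousAt (fun p : E × X => D1 F p.1 p.2) (y₀, x₀) := by
    have h1 : ContinuousAt (fun p : E × X =>
        (fderiv ℝ F p).comp (ContinuousLinearMap.inl ℝ E X)) (y₀, x₀) :=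
      (hcont.continuousAt hDn).clm_comp continuousAt_const
    refine h1.congr ?_
    filter_upwards [hDn] with p hp
    exact (hD1 p.1 p.2 hp).symm
  have hcx : ContinuousAt (fun x : X => D1 F y₀ x) x₀ :=
    ContinuousAt.comp (f := fun x : X => (y₀, x)) (x := x₀) hc0 (by fun_prop)
  obtain ⟨G₀, hG₀⟩ := (D1 F y₀ x₀).toLinearMap.exists_rightInverse_of_surjective
    (LinearMap.range_eq_top.2 hsurj)
  let G : P →L[ℝ] E := LinearMap.toContinuousLinearMap G₀
  have hG : (D1 F y₀ x₀).comp G = 1 := by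
    ext w
    exact congrArg (fun f : P →ₗ[ℝ] P => f w) hG₀
  haveI : CompleteSpace P := FiniteDimensional.complete ℝ P
  have hM : ContinuousAt (fun x : X => (D1 F y₀ x).comp G) x₀ := hcx.clm_comp continuousAt_const
  have hunit : ∀ᶠ x in 𝓝 x₀, IsUnit ((D1 F y₀ x).comp G) := by
    have : {f : P →L[ℝ] P | IsUnit f} ∈ 𝓝 ((D1 F y₀ x₀).comp G) := by
      rw [hG]
      exact Units.isOpen.mem_nhds isUnit_one
    exact hM this
  have hinv : ContinuousAt (fun x : X => G.comp (Ring.inverse ((D1 F y₀ x).comp G))) x₀ := by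
    refine continuousAt_const.clm_comp ?_
    refine ContinuousAt.comp (g := Ring.inverse) (f := fun x : X => (D1 F y₀ x).comp G) ?_ hM
    have := NormedRing.inverse_continuousAt (1 : (P →L[ℝ] P)ˣ)
    simpa only [hG, Units.val_one] using this
  set C : ℝ := ‖G.comp (Ring.inverse ((D1 F y₀ x₀).comp G))‖ + 1 with hC
  have hCpos : 0 < C := by positivity
  have hbound : ∀ᶠ x in 𝓝 x₀, ‖G.comp (Ring.inverse ((D1 F y₀ x).comp G))‖ < C :=
    hinv.norm.eventually_lt continuousAt_const (by simp [hC])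
  have hcpos : 0 < ε / C / 2 := by positivity
  have hclose : ∀ᶠ p in 𝓝 (y₀, x₀), p ∈ D ∧
      dist (D1 F p.1 p.2) (D1 F y₀ x₀) < ε / C / 2 :=
    (eventually_mem_set.2 hDn).and (hc0 (Metric.ball_mem_nhds _ hcpos))
  obtain ⟨δ, hδ, hball⟩ := Metric.eventually_nhds_iff_ball.1 hclose
  have hin : ∀ y ∈ Metric.closedBall y₀ (δ / 2), ∀ x ∈ Metric.ball x₀ δ,
      (y, x) ∈ D ∧ dist (D1 F y x) (D1 F y₀ x₀) < ε / C / 2 := by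
    intro y hy x hx
    refine hball (y, x) ?_
    rw [← ball_prod_same]
    exact ⟨Metric.closedBall_subset_ball (by linarith) hy, hx⟩
  have hr : 0 < δ / 2 := by positivity
  refine ⟨δ / 2, hr, Metric.ball x₀ δ ∩ {x | IsUnit ((D1 F y₀ x).comp G) ∧
    ‖G.comp (Ring.inverse ((D1 F y₀ x).comp G))‖ < C},
    inter_mem (Metric.ball_mem_nhds _ hδ) (hunit.and hbound), ?_, ?_⟩
  · rintro ⟨y, x⟩ ⟨hy, hx⟩
    exact (hin y hy x hx.1).1
  · rintro y hy x ⟨hx, hu, hb⟩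
    rw [Metric.mem_ball, dist_eq_norm, lt_div_iff₀ (by linarith)] at hy
    have hy0 : y₀ ∈ Metric.closedBall y₀ (δ / 2) := Metric.mem_closedBall_self hr.le
    have hyc : y ∈ Metric.closedBall y₀ (δ / 2) := by
      rw [Metric.mem_closedBall, dist_eq_norm]
      nlinarith [norm_nonneg (y - y₀)]
    have hmv : ‖F (y, x) - F (y₀, x) - D1 F y₀ x (y - y₀)‖ ≤ ε / C * ‖y - y₀‖ := by
      refine (convex_closedBall y₀ (δ / 2)).norm_image_sub_le_of_norm_hasFDerivWithin_le'
        (f := fun y' => F (y', x)) (f' := fun y' => D1 F y' x)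
        (fun z hz => (hder z x (hin z hz x hx).1).hasFDerivWithinAt) ?_ hy0 hyc
      intro z hz
      rw [← dist_eq_norm]
      have h1 := (hin z hz x hx).2
      have h2 := (hin y₀ hy0 x hx).2
      have h3 := dist_triangle_right (D1 F z x) (D1 F y₀ x) (D1 F y₀ x₀)
      linarith
    set w := F (y, x) - F (y₀, x) - D1 F y₀ x (y - y₀) with hw
    set z := (G.comp (Ring.inverse ((D1 F y₀ x).comp G))) w with hz
    have hAz : D1 F y₀ x z = w := by
      have := Ring.mul_inverse_cancel _ hu
      exact congrArg (fun f : P →L[ℝ] P => f w) this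
    have hzn : ‖z‖ ≤ ε * ‖y - y₀‖ := by
      calc ‖z‖ ≤ ‖G.comp (Ring.inverse ((D1 F y₀ x).comp G))‖ * ‖w‖ :=
            ContinuousLinearMap.le_opNorm _ _
        _ ≤ C * (ε / C * ‖y - y₀‖) := by gcongr
        _ = ε * ‖y - y₀‖ := by field_simp
    refine ⟨y + z, ?_, ?_, ?_⟩
    · rw [Metric.mem_ball, dist_eq_norm]
      have : ‖y + z - y₀‖ ≤ ‖y - y₀‖ + ‖z‖ := by
        rw [show y + z - y₀ = (y - y₀) + z by abel]
        exact norm_add_le _ _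
      linarith
    · rw [show y + z - y₀ = (y - y₀) + z by abel, map_add, hAz, hw]
      abel
    · simpa using hzn
end

section
/- (First equivalence) There is a neighborhood of x₀ on which both μ_F(x) = min{‖y − y₀‖ : F(y, x) = 0} and μ₁(x) = min{‖y − y₀‖ : F¹(y, x) = 0} are well defined, and μ_F and μ₁ are asymptotically equal at x₀. -/
open Filter Topology Set

/-- Asymptotic equality at `x₀`. -/
def AsympEq {X : Type*} [TopologicalSpace X] (x₀ : X) (f g : X → ℝ) : Prop :=
  ∀ ε > (0 : ℝ), ∃ N ∈ 𝓝 x₀, ∀ x ∈ N, (1 - ε) * g x ≤ f x ∧ f x ≤ (1 + ε) * g x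

lemma aux_solve {E P : Type*}
    [NormedAddCommGroup E] [NormedSpace ℝ E] [CompleteSpace E]
    [NormedAddCommGroup P] [NormedSpace ℝ P]
    {A : E →L[ℝ] P} (R : A.NonlinearRightInverse) (hR : 0 < R.nnnorm)
    {f : E → P} {s : Set E} {c : NNReal} (hf : ApproximatesLinearOn f A s c)
    (hc : 2 * (R.nnnorm : ℝ) * c ≤ 1) (b : E)
    (hs : Metric.closedBall b (2 * R.nnnorm * ‖f b‖) ⊆ s) :
    ∃ y, f y = 0 ∧ ‖y - b‖ ≤ 2 * R.nnnorm * ‖f b‖ := by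
  have hK : (0 : ℝ) < R.nnnorm := by exact_mod_cast hR
  have h := hf.surjOn_closedBall_of_nonlinearRightInverse R
    (ε := 2 * R.nnnorm * ‖f b‖) (by positivity) hs
  have h0 : (0 : P) ∈ Metric.closedBall (f b)
      (((R.nnnorm : ℝ)⁻¹ - c) * (2 * R.nnnorm * ‖f b‖)) := by
    rw [Metric.mem_closedBall, dist_zero_left]
    have : ((R.nnnorm : ℝ)⁻¹ - c) * (2 * R.nnnorm * ‖f b‖)
        = (2 - 2 * (R.nnnorm : ℝ) * c) * ‖f b‖ := by
      field_simp
    rw [this]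
    nlinarith [norm_nonneg (f b)]
  obtain ⟨y, hy, hy0⟩ := h h0
  exact ⟨y, hy0, by simpa [dist_eq_norm] using hy⟩

lemma aux_min {E : Type*} [NormedAddCommGroup E] [ProperSpace E]
    (S : Set E) (y₀ y : E) (R : ℝ) (hy : y ∈ S) (hyR : ‖y - y₀‖ ≤ R)
    (hS : IsClosed (Metric.closedBall y₀ R ∩ S)) :
    ∃ z ∈ S, ∀ w ∈ S, ‖z - y₀‖ ≤ ‖w - y₀‖ := by
  have hcomp : IsCompact (Metric.closedBall y₀ R ∩ S) :=
    (isCompact_closedBall y₀ R).of_isClosed_subset hS inter_subset_left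
  obtain ⟨z, hz, hmin⟩ := hcomp.exists_isMinOn (f := fun z => ‖z - y₀‖)
    ⟨y, by simpa [dist_eq_norm] using hyR, hy⟩ (by fun_prop)
  refine ⟨z, hz.2, fun w hw => ?_⟩
  by_cases hwR : ‖w - y₀‖ ≤ R
  · exact hmin ⟨by simpa [dist_eq_norm] using hwR, hw⟩
  · have := hz.1
    rw [Metric.mem_closedBall, dist_eq_norm] at this
    linarith

lemma aux_approx {E X P : Type*}
    [NormedAddCommGroup E] [NormedSpace ℝ E]
    [NormedAddCommGroup X] [NormedSpace ℝ X]
    [NormedAddCommGroup P] [NormedSpace ℝ P]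
    (D : Set (E × X)) (hD : IsOpen D) (y₀ : E) (x₀ : X) (hmem : (y₀, x₀) ∈ D)
    (F : E × X → P) (hF : ContDiffOn ℝ 1 F D) (c : NNReal) (hc : 0 < c) :
    ∃ r > 0, ∀ x ∈ Metric.closedBall x₀ r,
      (∀ y ∈ Metric.closedBall y₀ r, (y, x) ∈ D) ∧
      ApproximatesLinearOn (fun y => F (y, x)) (D1 F y₀ x₀) (Metric.closedBall y₀ r) c ∧
      ‖D1 F y₀ x - D1 F y₀ x₀‖ ≤ c := by
  have hdiff : ∀ y x, (y, x) ∈ D → HasFDerivAt (fun y' => F (y', x)) 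
      ((fderiv ℝ F (y, x)).comp (ContinuousLinearMap.inl ℝ E X)) y := by
    intro y x h
    have h1 : DifferentiableAt ℝ F (y, x) :=
      (hF.differentiableOn (by norm_num)).differentiableAt (hD.mem_nhds h)
    exact h1.hasFDerivAt.comp y (hasFDerivAt_prodMk_left y x)
  have hstrict : HasStrictFDerivAt F (fderiv ℝ F (y₀, x₀)) (y₀, x₀) :=
    (hF.contDiffAt (hD.mem_nhds hmem)).hasStrictFDerivAt (by norm_num)
  obtain ⟨s, hs, happ⟩ := hstrict.approximates_deriv_on_nhds (c := c) (Or.inr hc)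
  obtain ⟨r, hr, hrs⟩ := Metric.nhds_basis_closedBall.mem_iff.1
    (inter_mem hs (hD.mem_nhds hmem))
  have hA : D1 F y₀ x₀ = (fderiv ℝ F (y₀, x₀)).comp (ContinuousLinearMap.inl ℝ E X) :=
    (hdiff _ _ hmem).fderiv
  refine ⟨r, hr, fun x hx => ?_⟩
  have hin : ∀ y ∈ Metric.closedBall y₀ r, (y, x) ∈ s ∩ D := by
    intro y hy
    apply hrs
    rw [← closedBall_prod_same]
    exact ⟨hy, hx⟩
  have hap : ApproximatesLinearOn (fun y => F (y, x)) (D1 F y₀ x₀)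
      (Metric.closedBall y₀ r) c := by
    refine fun y hy z hz => ?_
    have := happ _ (hin y hy).1 _ (hin z hz).1
    rw [hA]
    simpa [Prod.norm_def] using this
  refine ⟨fun y hy => (hin y hy).2, hap, ?_⟩
  have h1 := hdiff y₀ x (hin y₀ (Metric.mem_closedBall_self hr.le)).2
  have h2 : HasFDerivAt (fun y' => F (y', x)) (D1 F y₀ x) y₀ :=
    h1.differentiableAt.hasFDerivAt
  exact (h2.sub (D1 F y₀ x₀).hasFDerivAt).le_of_lipschitzOn
    (Metric.closedBall_mem_nhds y₀ hr) hap.lipschitzOnWith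

lemma aux_main {E X P : Type*}
    [NormedAddCommGroup E] [NormedSpace ℝ E] [FiniteDimensional ℝ E]
    [NormedAddCommGroup X] [NormedSpace ℝ X]
    [NormedAddCommGroup P] [NormedSpace ℝ P]
    (D : Set (E × X)) (hD : IsOpen D) (y₀ : E) (x₀ : X) (hmem : (y₀, x₀) ∈ D)
    (F : E × X → P) (hF : ContDiffOn ℝ 1 F D) (hF0 : F (y₀, x₀) = 0)
    (R : (D1 F y₀ x₀).NonlinearRightInverse) (hR : 0 < R.nnnorm)
    (c : NNReal) (hc : 0 < c) (hRc : 2 * (R.nnnorm : ℝ) * c ≤ 1) :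
    ∀ᶠ x in 𝓝 x₀, ∃ m₁ mF : ℝ, 0 ≤ m₁ ∧ 0 ≤ mF ∧
      IsLeast {r : ℝ | ∃ y : E, (y, x) ∈ D ∧ F (y, x) = 0 ∧ r = ‖y - y₀‖} mF ∧
      IsLeast {r : ℝ | ∃ y : E, D1 F y₀ x (y - y₀) + F (y₀, x) = 0 ∧ r = ‖y - y₀‖} m₁ ∧
      mF ≤ (1 + 4 * R.nnnorm * c) * m₁ ∧ m₁ ≤ (1 + 4 * R.nnnorm * c) * mF := by
  have : ProperSpace E := FiniteDimensional.proper ℝ E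
  have : CompleteSpace E := FiniteDimensional.complete ℝ E
  obtain ⟨r, hr, H⟩ := aux_approx D hD y₀ x₀ hmem F hF c hc
  have hK : (0 : ℝ) < R.nnnorm := by exact_mod_cast hR
  have hcont : ContinuousAt (fun x => 2 * R.nnnorm * ‖F (y₀, x)‖) x₀ := by
    have h1 : ContinuousAt F (y₀, x₀) := hF.continuousOn.continuousAt (hD.mem_nhds hmem)
    have h2 : ContinuousAt (fun x => F (y₀, x)) x₀ :=
      ContinuousAt.comp (f := fun x => (y₀, x)) h1 (by fun_prop)
    exact continuousAt_const.mul h2.norm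
  have hsmall : ∀ᶠ x in 𝓝 x₀, 2 * R.nnnorm * ‖F (y₀, x)‖ < r / 4 :=
    hcont.eventually_lt continuousAt_const (by simp [hF0]; linarith)
  filter_upwards [hsmall, Metric.closedBall_mem_nhds x₀ hr] with x hx hxr
  obtain ⟨hDx, happ, hA⟩ := H x hxr
  have hy0r : y₀ ∈ Metric.closedBall y₀ r := Metric.mem_closedBall_self hr.le
  -- the linearization approximates
  have hlin : ApproximatesLinearOn (fun y => D1 F y₀ x (y - y₀) + F (y₀, x))
      (D1 F y₀ x₀) univ c := by
    refine fun y _ z _ => ?_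
    have e : D1 F y₀ x (y - y₀) + F (y₀, x) - (D1 F y₀ x (z - y₀) + F (y₀, x))
        - D1 F y₀ x₀ (y - z) = (D1 F y₀ x - D1 F y₀ x₀) (y - z) := by
      simp only [map_sub, ContinuousLinearMap.sub_apply]; abel
    show ‖D1 F y₀ x (y - y₀) + F (y₀, x) - (D1 F y₀ x (z - y₀) + F (y₀, x))
        - D1 F y₀ x₀ (y - z)‖ ≤ _
    rw [e]
    exact (ContinuousLinearMap.le_opNorm _ _).trans (by gcongr)
  -- difference estimate
  have hdiff : ∀ y ∈ Metric.closedBall y₀ r,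
      ‖F (y, x) - (D1 F y₀ x (y - y₀) + F (y₀, x))‖ ≤ 2 * c * ‖y - y₀‖ := by
    intro y hy
    have h1 := happ y hy y₀ hy0r
    have h2 := (ContinuousLinearMap.le_opNorm (D1 F y₀ x - D1 F y₀ x₀) (y - y₀))
    have h3 : ‖D1 F y₀ x - D1 F y₀ x₀‖ * ‖y - y₀‖ ≤ c * ‖y - y₀‖ := by gcongr
    have e : F (y, x) - (D1 F y₀ x (y - y₀) + F (y₀, x)) =
        (F (y, x) - F (y₀, x) - D1 F y₀ x₀ (y - y₀))
          - (D1 F y₀ x - D1 F y₀ x₀) (y - y₀) := by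
      simp only [ContinuousLinearMap.sub_apply]; abel
    rw [e]
    refine (norm_sub_le _ _).trans ?_
    simp only at h1
    linarith
  -- minimizers
  obtain ⟨a, ha0, ha⟩ := aux_solve R hR happ hRc y₀
    (Metric.closedBall_subset_closedBall (by linarith))
  obtain ⟨yF, ⟨hyFD, hyF0⟩, hyFmin⟩ := aux_min {y | (y, x) ∈ D ∧ F (y, x) = 0} y₀ a r
    ⟨hDx a (by rw [Metric.mem_closedBall, dist_eq_norm]; linarith), ha0⟩ (by linarith) (by
      have hco : ContinuousOn (fun y => F (y, x)) (Metric.closedBall y₀ r) :=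
        happ.continuousOn
      convert hco.preimage_isClosed_of_isClosed Metric.isClosed_closedBall
        (isClosed_singleton (x := (0 : P))) using 1
      ext y
      simp only [mem_inter_iff, mem_setOf_eq, mem_preimage, mem_singleton_iff]
      exact ⟨fun h => ⟨h.1, h.2.2⟩, fun h => ⟨h.1, hDx y h.1, h.2⟩⟩)
  obtain ⟨b, hb0, hb⟩ := aux_solve R hR hlin hRc y₀ (subset_univ _)
  simp only [sub_self, map_zero, zero_add] at hb
  obtain ⟨y1, hy10, hy1min⟩ := aux_min {y | D1 F y₀ x (y - y₀) + F (y₀, x) = 0} y₀ b r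
    hb0 (by linarith) (Metric.isClosed_closedBall.inter
      (isClosed_eq (by fun_prop) continuous_const))
  have hyFr : ‖yF - y₀‖ ≤ r / 4 := by
    have := hyFmin a ⟨hDx a (by rw [Metric.mem_closedBall, dist_eq_norm]; linarith), ha0⟩
    linarith
  have hy1r : ‖y1 - y₀‖ ≤ r / 4 := by
    have := hy1min b hb0
    linarith
  simp only [mem_setOf_eq] at hy10
  refine ⟨‖y1 - y₀‖, ‖yF - y₀‖, norm_nonneg _, norm_nonneg _,
    ⟨⟨yF, hyFD, hyF0, rfl⟩, ?_⟩, ⟨⟨y1, hy10, rfl⟩, ?_⟩, ?_, ?_⟩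
  · rintro _ ⟨y, h1, h2, rfl⟩
    exact hyFmin y ⟨h1, h2⟩
  · rintro _ ⟨y, h1, rfl⟩
    exact hy1min y h1
  · have h1 := hdiff y1 (by rw [Metric.mem_closedBall, dist_eq_norm]; linarith)
    rw [hy10, sub_zero] at h1
    have h2 : 2 * (R.nnnorm : ℝ) * ‖F (y1, x)‖ ≤ 4 * R.nnnorm * c * ‖y1 - y₀‖ := by
      nlinarith
    have h3 : 4 * (R.nnnorm : ℝ) * c * ‖y1 - y₀‖ ≤ r / 2 := by
      nlinarith [norm_nonneg (y1 - y₀)]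
    obtain ⟨y, hy0, hy⟩ := aux_solve R hR happ hRc y1
      (Metric.closedBall_subset_closedBall' (by rw [dist_eq_norm]; linarith))
    have h4 : ‖y - y₀‖ ≤ ‖y - y1‖ + ‖y1 - y₀‖ := norm_sub_le_norm_sub_add_norm_sub _ _ _
    have h5 := hyFmin y ⟨hDx y (by rw [Metric.mem_closedBall, dist_eq_norm]; linarith), hy0⟩
    linarith
  · have h1 := hdiff yF (by rw [Metric.mem_closedBall, dist_eq_norm]; linarith)
    rw [hyF0, zero_sub, norm_neg] at h1
    obtain ⟨y, hy0, hy⟩ := aux_solve R hR hlin hRc yF (subset_univ _)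
    have h2 : 2 * (R.nnnorm : ℝ) * ‖D1 F y₀ x (yF - y₀) + F (y₀, x)‖
        ≤ 4 * R.nnnorm * c * ‖yF - y₀‖ := by
      nlinarith
    have h4 : ‖y - y₀‖ ≤ ‖y - yF‖ + ‖yF - y₀‖ := norm_sub_le_norm_sub_add_norm_sub _ _ _
    have h5 := hy1min y hy0
    linarith

/-- First equivalence: on a neighborhood of `x₀` the values
`μ_F(x) = min {‖y − y₀‖ : F(y,x) = 0}` and
`μ₁(x) = min {‖y − y₀‖ : F¹(y,x) = 0}` are both well defined, and they are
asymptotically equal at `x₀`. -/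
theorem stmt_11 {E X P : Type*}
    [NormedAddCommGroup E] [NormedSpace ℝ E] [FiniteDimensional ℝ E]
    [NormedAddCommGroup X] [NormedSpace ℝ X] [FiniteDimensional ℝ X]
    [NormedAddCommGroup P] [NormedSpace ℝ P] [FiniteDimensional ℝ P]
    (D : Set (E × X)) (hD : IsOpen D) (y₀ : E) (x₀ : X) (hmem : (y₀, x₀) ∈ D)
    (F : E × X → P) (hF : ContDiffOn ℝ 1 F D) (hF0 : F (y₀, x₀) = 0)
    (hsurj : Function.Surjective (D1 F y₀ x₀)) :
    ∃ N ∈ 𝓝 x₀, ∃ μF μ₁ : X → ℝ,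
      (∀ x ∈ N,
        IsLeast {r : ℝ | ∃ y : E, (y, x) ∈ D ∧ F (y, x) = 0 ∧ r = ‖y - y₀‖} (μF x) ∧
        IsLeast {r : ℝ | ∃ y : E, D1 F y₀ x (y - y₀) + F (y₀, x) = 0 ∧ r = ‖y - y₀‖}
          (μ₁ x)) ∧
      AsympEq x₀ μF μ₁ := by
  have : CompleteSpace E := FiniteDimensional.complete ℝ E
  have : CompleteSpace P := FiniteDimensional.complete ℝ P
  have hrange : (D1 F y₀ x₀).range = ⊤ := LinearMap.range_eq_top.2 hsurj
  set R := (D1 F y₀ x₀).nonlinearRightInverseOfSurjective hrange with hRdef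
  have hR : 0 < R.nnnorm :=
    (D1 F y₀ x₀).nonlinearRightInverseOfSurjective_nnnorm_pos hrange
  have hK : (0 : ℝ) < R.nnnorm := by exact_mod_cast hR
  have main := aux_main D hD y₀ x₀ hmem F hF hF0 R hR
  refine ⟨_, main (1 / (2 * R.nnnorm)) (by positivity) (by push_cast; field_simp; norm_num),
    fun x => sInf {r : ℝ | ∃ y : E, (y, x) ∈ D ∧ F (y, x) = 0 ∧ r = ‖y - y₀‖},
    fun x => sInf {r : ℝ | ∃ y : E, D1 F y₀ x (y - y₀) + F (y₀, x) = 0 ∧ r = ‖y - y₀‖},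
    ?_, ?_⟩
  · rintro x ⟨m₁, mF, -, -, h1, h2, -, -⟩
    simp only [h1.csInf_eq, h2.csInf_eq]
    exact ⟨h1, h2⟩
  · intro ε hε
    obtain ⟨δ, hδ, hδε, hδ1⟩ : ∃ δ : ℝ, 0 < δ ∧ δ ≤ ε ∧ δ ≤ 1 :=
      ⟨min ε 1, by positivity, min_le_left _ _, min_le_right _ _⟩
    have hcr : ((Real.toNNReal (δ / (4 * R.nnnorm)) : NNReal) : ℝ) = δ / (4 * R.nnnorm) :=
      Real.coe_toNNReal _ (by positivity)
    have e4 : 4 * (R.nnnorm : ℝ) * (δ / (4 * R.nnnorm)) = δ := by field_simp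
    refine ⟨_, main (Real.toNNReal (δ / (4 * R.nnnorm)))
      (Real.toNNReal_pos.2 (by positivity)) (by rw [hcr]; linarith), ?_⟩
    rintro x ⟨m₁, mF, p1, p2, h1, h2, h3, h4⟩
    rw [hcr, e4] at h3 h4
    simp only [h1.csInf_eq, h2.csInf_eq]
    constructor
    · have : (1 - δ) * m₁ ≤ mF := by
        have := mul_le_mul_of_nonneg_left h4 (sub_nonneg.2 hδ1)
        nlinarith [mul_nonneg (sq_nonneg δ) p2]
      nlinarith
    · nlinarith
end
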